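/- arXiv:2212.08507 — 3 statements merged into one kernel-verified Lean document; each statement's English description precedes it below -/
import Mathlib

section
/- Let A^L, A^U be real n×m matrices with A^L ≤ A^U entrywise, and let B^L, B^U be real m×k matrices with B^L ≤ B^U entrywise. Define the centers A^μ = (A^L + A^U)/2, B^μ = (B^L + B^U)/2 and radii A^r = (A^U − A^L)/2, B^r = (B^U − B^L)/2. Then for every matrix A with A^L ≤ A ≤ A^U entrywise and every matrix B with B^L ≤ B ≤ B^U entrywise, the entrywise bound |A B − A^μ B^μ| ≤ |A^μ| B^r + A^r |B^μ| + A^r B^r holds, where the absolute value on the left is taken entrywise. -/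
/-- Two-sided reformulation of Lemma 1: entrywise
`|A B − Aμ Bμ| ≤ |Aμ| Br + Ar |Bμ| + Ar Br`. -/
theorem stmt_1 {n m k : ℕ}
    (AL AU A : Matrix (Fin n) (Fin m) ℝ)
    (BL BU B : Matrix (Fin m) (Fin k) ℝ)
    (hALU : ∀ i j, AL i j ≤ AU i j)
    (hBLU : ∀ i j, BL i j ≤ BU i j)
    (hAL : ∀ i j, AL i j ≤ A i j) (hAU : ∀ i j, A i j ≤ AU i j)
    (hBL : ∀ i j, BL i j ≤ B i j) (hBU : ∀ i j, B i j ≤ BU i j)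
    (Aμ Ar : Matrix (Fin n) (Fin m) ℝ)
    (Bμ Br : Matrix (Fin m) (Fin k) ℝ)
    (hAμ : Aμ = Matrix.of fun i j => (AL i j + AU i j) / 2)
    (hAr : Ar = Matrix.of fun i j => (AU i j - AL i j) / 2)
    (hBμ : Bμ = Matrix.of fun i j => (BL i j + BU i j) / 2)
    (hBr : Br = Matrix.of fun i j => (BU i j - BL i j) / 2) :
    ∀ i j,
      |(A * B) i j - (Aμ * Bμ) i j|
        ≤ ((Matrix.of fun i j => |Aμ i j|) * Br) i j
          + (Ar * (Matrix.of fun i j => |Bμ i j|)) i j + (Ar * Br) i j := by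
  intro i j
  have ha : ∀ l, |A i l - Aμ i l| ≤ Ar i l := by
    intro l
    have h1 := hAL i l
    have h2 := hAU i l
    rw [hAμ, hAr, abs_le]
    simp only [Matrix.of_apply]
    constructor <;> linarith
  have hb : ∀ l, |B l j - Bμ l j| ≤ Br l j := by
    intro l
    have h1 := hBL l j
    have h2 := hBU l j
    rw [hBμ, hBr, abs_le]
    simp only [Matrix.of_apply]
    constructor <;> linarith
  clear hAμ hAr hBμ hBr
  simp only [Matrix.mul_apply, Matrix.of_apply]
  rw [← Finset.sum_sub_distrib, ← Finset.sum_add_distrib, ← Finset.sum_add_distrib]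
  refine (Finset.abs_sum_le_sum_abs _ _).trans (Finset.sum_le_sum fun l _ => ?_)
  have e : A i l * B l j - Aμ i l * Bμ l j = Aμ i l * (B l j - Bμ l j)
      + (A i l - Aμ i l) * Bμ l j + (A i l - Aμ i l) * (B l j - Bμ l j) := by ring
  have hr : 0 ≤ Ar i l := (abs_nonneg _).trans (ha l)
  rw [e]
  refine (abs_add_three _ _ _).trans ?_
  rw [abs_mul, abs_mul, abs_mul]
  exact add_le_add (add_le_add
    (mul_le_mul_of_nonneg_left (hb l) (abs_nonneg _))
    (mul_le_mul_of_nonneg_right (ha l) (abs_nonneg _)))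
    (mul_le_mul (ha l) (hb l) (abs_nonneg _) hr)
end

section
/- Let a^L ≤ a^U and b^L ≤ b^U be real numbers, and set a^μ = (a^L + a^U)/2, b^μ = (b^L + b^U)/2, a^r = (a^U − a^L)/2, b^r = (b^U − b^L)/2. Then for all real a ∈ [a^L, a^U] and b ∈ [b^L, b^U], one has |a·b − a^μ·b^μ| ≤ |a^μ|·b^r + a^r·|b^μ| + a^r·b^r. -/
/-- Scalar core of Lemma 1: for `a ∈ [aL, aU]`, `b ∈ [bL, bU]`, with centers
`aμ, bμ` and radii `ar, br`, `|a·b − aμ·bμ| ≤ |aμ|·br + ar·|bμ| + ar·br`. -/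
theorem stmt_2 (aL aU bL bU a b aμ bμ ar br : ℝ)
    (haLU : aL ≤ aU) (hbLU : bL ≤ bU)
    (haμ : aμ = (aL + aU) / 2) (hbμ : bμ = (bL + bU) / 2)
    (har : ar = (aU - aL) / 2) (hbr : br = (bU - bL) / 2)
    (ha : a ∈ Set.Icc aL aU) (hb : b ∈ Set.Icc bL bU) :
    |a * b - aμ * bμ| ≤ |aμ| * br + ar * |bμ| + ar * br := by
  obtain ⟨ha1, ha2⟩ := ha
  obtain ⟨hb1, hb2⟩ := hb
  have hA : |a - aμ| ≤ ar := by
    rw [abs_le]; constructor <;> linarith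
  have hB : |b - bμ| ≤ br := by
    rw [abs_le]; constructor <;> linarith
  have har0 : 0 ≤ ar := (abs_nonneg _).trans hA
  have e : a * b - aμ * bμ = aμ * (b - bμ) + (a - aμ) * bμ + (a - aμ) * (b - bμ) := by ring
  rw [e]
  calc |aμ * (b - bμ) + (a - aμ) * bμ + (a - aμ) * (b - bμ)|
      ≤ |aμ * (b - bμ)| + |(a - aμ) * bμ| + |(a - aμ) * (b - bμ)| := abs_add_three _ _ _
    _ = |aμ| * |b - bμ| + |a - aμ| * |bμ| + |a - aμ| * |b - bμ| := by simp only [abs_mul]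
    _ ≤ |aμ| * br + ar * |bμ| + ar * br := by gcongr
end

section
/- Let σ : ℝ → ℝ be monotone (nondecreasing). Let W^L ≤ W^U be real m×n matrices, b^L ≤ b^U vectors in ℝ^m, and x^L ≤ x^U vectors in ℝⁿ (all inequalities entrywise). Define W^μ = (W^L + W^U)/2, W^r = (W^U − W^L)/2, x^μ = (x^L + x^U)/2, x^r = (x^U − x^L)/2, and the Lemma 1 bounds ζ^L = W^μ x^μ − |W^μ| x^r − W^r |x^μ| − W^r x^r and ζ^U = W^μ x^μ + |W^μ| x^r + W^r |x^μ| + W^r x^r. Then for every W with W^L ≤ W ≤ W^U, every b with b^L ≤ b ≤ b^U, and every x with x^L ≤ x ≤ x^U, the layer output satisfies, for each index i, σ(ζ^L_i + b^L_i) ≤ σ((W x + b)_i) ≤ σ(ζ^U_i + b^U_i). -/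
theorem aux_entry (w wm wr x xm xr : ℝ) (hw : |w - wm| ≤ wr) (hx : |x - xm| ≤ xr) :
    |w * x - wm * xm| ≤ |wm| * xr + wr * |xm| + wr * xr := by
  have h : w * x - wm * xm = wm * (x - xm) + (w - wm) * xm + (w - wm) * (x - xm) := by ring
  have hwr : 0 ≤ wr := (abs_nonneg _).trans hw
  rw [h]
  refine (abs_add_three _ _ _).trans ?_
  rw [abs_mul, abs_mul, abs_mul]
  gcongr

/-- Soundness of one step of forward-pass interval propagation: jointly
propagating an input box and a weight box through an affine layer followed by
a monotone activation yields valid componentwise output bounds. -/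
theorem stmt_10 {n m : ℕ} (σ : ℝ → ℝ) (hσ : Monotone σ)
    (WL WU W : Matrix (Fin m) (Fin n) ℝ)
    (bL bU b : Fin m → ℝ) (xL xU x : Fin n → ℝ)
    (hWLU : ∀ i j, WL i j ≤ WU i j)
    (hbLU : ∀ i, bL i ≤ bU i)
    (hxLU : ∀ i, xL i ≤ xU i)
    (hWL : ∀ i j, WL i j ≤ W i j) (hWU : ∀ i j, W i j ≤ WU i j)
    (hbL : ∀ i, bL i ≤ b i) (hbU : ∀ i, b i ≤ bU i)
    (hxL : ∀ i, xL i ≤ x i) (hxU : ∀ i, x i ≤ xU i)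
    (Wμ Wr : Matrix (Fin m) (Fin n) ℝ) (xμ xr : Fin n → ℝ)
    (ζL ζU : Fin m → ℝ)
    (hWμ : Wμ = Matrix.of fun i j => (WL i j + WU i j) / 2)
    (hWr : Wr = Matrix.of fun i j => (WU i j - WL i j) / 2)
    (hxμ : xμ = fun i => (xL i + xU i) / 2)
    (hxr : xr = fun i => (xU i - xL i) / 2)
    (hζL : ζL = Wμ.mulVec xμ - (Matrix.of fun i j => |Wμ i j|).mulVec xr
        - Wr.mulVec (fun i => |xμ i|) - Wr.mulVec xr)
    (hζU : ζU = Wμ.mulVec xμ + (Matrix.of fun i j => |Wμ i j|).mulVec xr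
        + Wr.mulVec (fun i => |xμ i|) + Wr.mulVec xr) :
    ∀ i, σ (ζL i + bL i) ≤ σ ((W.mulVec x + b) i) ∧
      σ ((W.mulVec x + b) i) ≤ σ (ζU i + bU i) := by
  intro i
  have key : ∀ j, |W i j * x j - Wμ i j * xμ j| ≤
      |Wμ i j| * xr j + Wr i j * |xμ j| + Wr i j * xr j := by
    intro j
    apply aux_entry
    · rw [hWμ, hWr, abs_le]
      simp only [Matrix.of_apply]
      constructor <;> linarith [hWL i j, hWU i j]
    · rw [hxμ, hxr, abs_le]
      constructor <;> linarith [hxL j, hxU j]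
  constructor
  · apply hσ
    refine add_le_add ?_ (hbL i)
    rw [hζL]
    simp only [Pi.sub_apply, Matrix.mulVec, dotProduct, Matrix.of_apply]
    rw [← Finset.sum_sub_distrib, ← Finset.sum_sub_distrib, ← Finset.sum_sub_distrib]
    refine Finset.sum_le_sum fun j _ => ?_
    linarith [(abs_le.mp (key j)).1]
  · apply hσ
    refine add_le_add ?_ (hbU i)
    rw [hζU]
    simp only [Pi.add_apply, Matrix.mulVec, dotProduct, Matrix.of_apply]
    rw [← Finset.sum_add_distrib, ← Finset.sum_add_distrib, ← Finset.sum_add_distrib]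
    refine Finset.sum_le_sum fun j _ => ?_
    linarith [(abs_le.mp (key j)).2]
end
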